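/- (Uniqueness of the viscosity solution) If W : [0,T] × ℝⁿ → ℝ is a bounded uniformly continuous function which is both a viscosity subsolution and a viscosity supersolution of W_t + H(x, W_x, t) = 0 on (0,T) × ℝⁿ with H(x,p,t) = sup_{u∈U} ( ⟨p, f(x,u)⟩ − L(x,u,t) ), and W(0,·) = I, then W coincides with the value function V on [0,T] × ℝⁿ; in particular the value function is the unique such viscosity solution with initial datum I. -/

import Mathlib

open MeasureTheory Set
open scoped RealInnerProductSpace

noncomputable section

/-- Euclidean state space `ℝⁿ`. -/
abbrev En (n : ℕ) := EuclideanSpace ℝ (Fin n)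

/-- An admissible control–trajectory pair on `[a,b]`. -/
def IsAdmissible {n m : ℕ} (f : En n → En m → En n) (U : Set (En m)) (a b : ℝ)
    (u : ℝ → En m) (γ : ℝ → En n) : Prop :=
  Measurable u ∧ (∀ s ∈ Icc a b, u s ∈ U) ∧ ContinuousOn γ (Icc a b) ∧
    ∀ s ∈ Icc a b, γ s = γ a + ∫ r in a..s, f (γ r) (u r)

/-- The value function of the Bolza problem. -/
def valueFun {n m : ℕ} (f : En n → En m → En n) (U : Set (En m))
    (L : En n → En m → ℝ → ℝ) (I : En n → ℝ) (t : ℝ) (x : En n) : ℝ :=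
  sInf { J | ∃ u γ, IsAdmissible f U 0 t u γ ∧ γ t = x ∧
      J = (∫ s in (0:ℝ)..t, L (γ s) (u s) s) + I (γ 0) }

/-- The Hamiltonian `H(x,p,t) = sup_{u ∈ U} (⟨p, f(x,u)⟩ - L(x,u,t))`. -/
def ham {n m : ℕ} (f : En n → En m → En n) (U : Set (En m))
    (L : En n → En m → ℝ → ℝ) (x p : En n) (t : ℝ) : ℝ :=
  sSup { r | ∃ u ∈ U, r = ⟪p, f x u⟫ - L x u t }

section Trajectories

variable {n m : ℕ} {f : En n → En m → En n} {U : Set (En m)} {a b : ℝ}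
  {u : ℝ → En m} {γ : ℝ → En n}

lemma IsAdmissible.intervalIntegrable_comp {E : Type*} [NormedAddCommGroup E]
    (h : IsAdmissible f U a b u γ) (hU : IsCompact U) {G : En n × En m × ℝ → E}
    (hG : Continuous G) {c d : ℝ} (hc : c ∈ Icc a b) (hd : d ∈ Icc a b) :
    IntervalIntegrable (fun r => G (γ r, u r, r)) volume c d := by
  obtain ⟨hu, huU, hγ, -⟩ := h
  have hK : IsCompact ((γ '' Icc a b) ×ˢ U ×ˢ Icc a b) :=
    (isCompact_Icc.image_of_continuousOn hγ).prod (hU.prod isCompact_Icc)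
  obtain ⟨C, hC⟩ := hK.exists_bound_of_continuousOn hG.continuousOn
  have hint : IntegrableOn (fun r => G (γ r, u r, r)) (Icc a b) volume := by
    refine IntegrableOn.of_bound isCompact_Icc.measure_lt_top ?_ C ?_
    · have h1 : AEStronglyMeasurable γ (volume.restrict (Icc a b)) :=
        hγ.aestronglyMeasurable measurableSet_Icc
      have h2 : AEStronglyMeasurable u (volume.restrict (Icc a b)) := hu.aestronglyMeasurable
      exact hG.comp_aestronglyMeasurable
        (h1.prodMk (h2.prodMk measurable_id.aestronglyMeasurable))
    · filter_upwards [ae_restrict_mem measurableSet_Icc] with r hr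
      exact hC _ ⟨mem_image_of_mem _ hr, huU r hr, hr⟩
  refine (hint.mono_set ?_).intervalIntegrable
  exact (uIcc_subset_Icc hc hd)

lemma IsAdmissible.intervalIntegrable_velocity (h : IsAdmissible f U a b u γ) (hU : IsCompact U)
    (hf : Continuous fun p : En n × En m => f p.1 p.2) {c d : ℝ}
    (hc : c ∈ Icc a b) (hd : d ∈ Icc a b) :
    IntervalIntegrable (fun r => f (γ r) (u r)) volume c d :=
  h.intervalIntegrable_comp hU (G := fun p => f p.1 p.2.1)
    (hf.comp (continuous_fst.prodMk (continuous_fst.comp continuous_snd))) hc hd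

lemma IsAdmissible.sub_eq_integral (h : IsAdmissible f U a b u γ) (hU : IsCompact U)
    (hf : Continuous fun p : En n × En m => f p.1 p.2) {c d : ℝ}
    (hc : c ∈ Icc a b) (hd : d ∈ Icc a b) :
    γ d - γ c = ∫ r in c..d, f (γ r) (u r) := by
  have ha : a ∈ Icc a b := ⟨le_rfl, hc.1.trans hc.2⟩
  rw [h.2.2.2 d hd, h.2.2.2 c hc, add_sub_add_left_eq_sub]
  exact intervalIntegral.integral_interval_sub_left
    (h.intervalIntegrable_velocity hU hf ha hd) (h.intervalIntegrable_velocity hU hf ha hc)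

lemma IsAdmissible.norm_displacement_le (h : IsAdmissible f U a b u γ) (hU : IsCompact U)
    (hf : Continuous fun p : En n × En m => f p.1 p.2) {M : ℝ}
    (hM : ∀ r ∈ Icc a b, ‖f (γ r) (u r)‖ ≤ M) {c d : ℝ} (hac : a ≤ c) (hcd : c ≤ d)
    (hdb : d ≤ b) : ‖γ d - γ c‖ ≤ M * (d - c) := by
  rw [h.sub_eq_integral hU hf ⟨hac, hcd.trans hdb⟩ ⟨hac.trans hcd, hdb⟩,
    ← abs_of_nonneg (sub_nonneg.2 hcd)]
  refine intervalIntegral.norm_integral_le_of_norm_le_const fun q hq => ?_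
  rw [uIoc_of_le hcd] at hq
  exact hM q ⟨hac.trans hq.1.le, hq.2.trans hdb⟩

lemma IsAdmissible.restrict (h : IsAdmissible f U a b u γ) (hU : IsCompact U)
    (hf : Continuous fun p : En n × En m => f p.1 p.2) {c d : ℝ}
    (hac : a ≤ c) (hdb : d ≤ b) : IsAdmissible f U c d u γ := by
  refine ⟨h.1, fun s hs => h.2.1 s ⟨hac.trans hs.1, hs.2.trans hdb⟩,
    h.2.2.1.mono (Icc_subset_Icc hac hdb), fun s hs => ?_⟩
  rw [← h.sub_eq_integral hU hf ⟨hac, (hs.1.trans hs.2).trans hdb⟩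
    ⟨hac.trans hs.1, hs.2.trans hdb⟩, add_sub_cancel]

lemma isAdmissible_self (t : ℝ) (x : En n) {v : En m} (hv : v ∈ U) :
    IsAdmissible f U t t (fun _ => v) (fun _ => x) := by
  refine ⟨measurable_const, fun _ _ => hv, continuousOn_const, fun s hs => ?_⟩
  have : s = t := le_antisymm hs.2 hs.1
  simp [this]

lemma IsAdmissible.concat {c : ℝ} {u₁ u₂ : ℝ → En m} {γ₁ γ₂ : ℝ → En n}
    (h₁ : IsAdmissible f U a b u₁ γ₁) (h₂ : IsAdmissible f U b c u₂ γ₂) (hU : IsCompact U)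
    (hf : Continuous fun p : En n × En m => f p.1 p.2) (hab : a ≤ b) (hbc : b ≤ c)
    (hγ : γ₁ b = γ₂ b) :
    ∃ u γ, IsAdmissible f U a c u γ ∧ EqOn u u₁ (Ico a b) ∧ EqOn γ γ₁ (Icc a b) ∧
      EqOn u u₂ (Icc b c) ∧ EqOn γ γ₂ (Icc b c) := by
  set u : ℝ → En m := fun s => if s < b then u₁ s else u₂ s with hu
  set γ : ℝ → En n := fun s => if s < b then γ₁ s else γ₂ s with hγdef
  have e1 : EqOn u u₁ (Ico a b) := fun s hs => by simp [hu, hs.2]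
  have e2 : EqOn u u₂ (Icc b c) := fun s hs => by simp [hu, hs.1.not_gt]
  have e4 : EqOn γ γ₂ (Icc b c) := fun s hs => by simp [hγdef, hs.1.not_gt]
  have e3 : EqOn γ γ₁ (Icc a b) := fun s hs => by
    rcases hs.2.lt_or_eq with h | h
    · simp [hγdef, h]
    · simp [hγdef, h, hγ]
  have hcont : ContinuousOn γ (Icc a c) := by
    rw [← Icc_union_Icc_eq_Icc hab hbc]
    exact (h₁.2.2.1.congr e3).union_of_isClosed (h₂.2.2.1.congr e4) isClosed_Icc isClosed_Icc
  have i1 : ∀ s ∈ Icc a b, (∫ r in a..s, f (γ r) (u r)) = ∫ r in a..s, f (γ₁ r) (u₁ r) := by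
    intro s hs
    refine intervalIntegral.integral_congr_Ioo_of_le hs.1 fun r hr => ?_
    rw [e1 ⟨hr.1.le, hr.2.trans_le hs.2⟩, e3 ⟨hr.1.le, hr.2.le.trans hs.2⟩]
  have i2 : ∀ s ∈ Icc b c, (∫ r in b..s, f (γ r) (u r)) = ∫ r in b..s, f (γ₂ r) (u₂ r) := by
    intro s hs
    refine intervalIntegral.integral_congr_Ioo_of_le hs.1 fun r hr => ?_
    rw [e2 ⟨hr.1.le, hr.2.le.trans hs.2⟩, e4 ⟨hr.1.le, hr.2.le.trans hs.2⟩]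
  refine ⟨u, γ, ⟨Measurable.ite measurableSet_Iio h₁.1 h₂.1, fun s hs => ?_, hcont,
    fun s hs => ?_⟩, e1, e3, e2, e4⟩
  · rcases lt_or_ge s b with h | h
    · rw [e1 ⟨hs.1, h⟩]; exact h₁.2.1 s ⟨hs.1, h.le⟩
    · rw [e2 ⟨h, hs.2⟩]; exact h₂.2.1 s ⟨h, hs.2⟩
  · have ha : γ a = γ₁ a := e3 ⟨le_rfl, hab⟩
    rcases le_total s b with h | h
    · rw [e3 ⟨hs.1, h⟩, i1 s ⟨hs.1, h⟩, ha]; exact h₁.2.2.2 s ⟨hs.1, h⟩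
    · have j1 : IntervalIntegrable (fun r => f (γ r) (u r)) volume a b := by
        refine (h₁.intervalIntegrable_velocity hU hf ⟨le_rfl, hab⟩ ⟨hab, le_rfl⟩).congr_ae ?_
        rw [uIoc_of_le hab, restrict_Ioo_eq_restrict_Ioc.symm]
        filter_upwards [ae_restrict_mem measurableSet_Ioo] with r hr
        rw [e1 ⟨hr.1.le, hr.2⟩, e3 ⟨hr.1.le, hr.2.le⟩]
      have j2 : IntervalIntegrable (fun r => f (γ r) (u r)) volume b s := by
        refine (h₂.intervalIntegrable_velocity hU hf ⟨le_rfl, hbc⟩ ⟨h, hs.2⟩).congr ?_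
        rw [uIoc_of_le h]
        intro r hr
        simp only
        rw [e2 ⟨hr.1.le, hr.2.trans hs.2⟩, e4 ⟨hr.1.le, hr.2.trans hs.2⟩]
      rw [← intervalIntegral.integral_add_adjacent_intervals j1 j2, i1 b ⟨hab, le_rfl⟩,
        i2 s ⟨h, hs.2⟩, ha, e4 ⟨h, hs.2⟩, ← add_assoc, ← h₁.2.2.2 b ⟨hab, le_rfl⟩, hγ]
      exact h₂.2.2.2 s ⟨h, hs.2⟩

/-- A priori bound for trajectories of a vector field of linear growth, backwards in time. -/
lemma IsAdmissible.norm_le (h : IsAdmissible f U a b u γ) (hU : IsCompact U)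
    (hf : Continuous fun p : En n × En m => f p.1 p.2) {K₀ B : ℝ} (hK₀ : 0 < K₀)
    (hA1 : ∀ x u, ‖f x u‖ ≤ K₀ * (1 + ‖x‖ + ‖u‖)) (hB : ∀ v ∈ U, ‖v‖ ≤ B) (hB0 : 0 ≤ B)
    {s : ℝ} (hs : s ∈ Icc a b) :
    ‖γ s‖ ≤ 2 * Real.exp (2 * K₀ * (b - s)) * (1 + B + ‖γ b‖) := by
  have hab : a ≤ b := hs.1.trans hs.2
  have hb : b ∈ Icc a b := ⟨hab, le_rfl⟩
  set A := 1 + B + ‖γ b‖ with hA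
  have hA0 : 0 ≤ A := by positivity
  set g : ℝ → ℝ := fun r => Real.exp (-(2 * K₀ * (b - r))) * (1 + B + ‖γ r‖) with hg
  have hgc : ContinuousOn g (Icc a b) := by
    have := h.2.2.1
    fun_prop
  obtain ⟨q, hq, hmax⟩ := isCompact_Icc.exists_isMaxOn ⟨s, hs⟩ hgc
  set M := g q with hM
  have hle : ∀ r ∈ Icc a b, 1 + B + ‖γ r‖ ≤ M * Real.exp (2 * K₀ * (b - r)) := by
    intro r hr
    have h1 : g r ≤ M := hmax hr
    calc 1 + B + ‖γ r‖ = g r * Real.exp (2 * K₀ * (b - r)) := by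
          simp only [hg]
          rw [mul_right_comm, ← Real.exp_add]; simp
      _ ≤ _ := by gcongr
  have hint : ∫ r in q..b, K₀ * (M * Real.exp (2 * K₀ * (b - r)))
      = M / 2 * (Real.exp (2 * K₀ * (b - q)) - 1) := by
    rw [intervalIntegral.integral_eq_sub_of_hasDerivAt
      (f := fun r => -(M / 2 * Real.exp (2 * K₀ * (b - r))))]
    · simp; ring
    · intro r _
      have : HasDerivAt (fun r => 2 * K₀ * (b - r)) (2 * K₀ * (0 - 1)) r :=
        ((hasDerivAt_const r b).sub (hasDerivAt_id r)).const_mul _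
      refine ((this.exp).const_mul (M / 2)).fun_neg.congr_deriv ?_
      ring
    · exact (by fun_prop : Continuous fun r => K₀ * (M * Real.exp (2 * K₀ * (b - r)))).intervalIntegrable _ _
  have hvel : ‖∫ r in q..b, f (γ r) (u r)‖ ≤ ∫ r in q..b, K₀ * (M * Real.exp (2 * K₀ * (b - r))) := by
    refine intervalIntegral.norm_integral_le_of_norm_le hq.2 ?_ ?_
    · refine Filter.Eventually.of_forall fun r hr => ?_
      have hr' : r ∈ Icc a b := ⟨hq.1.trans hr.1.le, hr.2⟩
      refine (hA1 _ _).trans ?_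
      have := hle r hr'
      have := hB _ (h.2.1 r hr')
      gcongr
      linarith
    · exact (by fun_prop : Continuous fun r => K₀ * (M * Real.exp (2 * K₀ * (b - r)))).intervalIntegrable _ _
  have hq1 : 1 + B + ‖γ q‖ ≤ A + M / 2 * (Real.exp (2 * K₀ * (b - q)) - 1) := by
    have h1 := h.sub_eq_integral hU hf hq hb
    have h2 : ‖γ q‖ ≤ ‖γ b‖ + ‖γ b - γ q‖ := by
      have := norm_sub_le (γ b) (γ b - γ q)
      simpa using this
    rw [h1] at h2
    linarith
  have hE : Real.exp (-(2 * K₀ * (b - q))) ≤ 1 := by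
    rw [Real.exp_le_one_iff]
    have := hq.2
    have : 0 ≤ 2 * K₀ * (b - q) := by
      have : 0 ≤ b - q := by linarith
      positivity
    linarith
  have hM0 : 0 ≤ M := by
    simp only [hM, hg]; positivity
  have hM2 : M ≤ 2 * A := by
    have h1 : M ≤ Real.exp (-(2 * K₀ * (b - q))) *
        (A + M / 2 * (Real.exp (2 * K₀ * (b - q)) - 1)) := by
      simp only [hM, hg] at hq1 ⊢
      gcongr
    have h2 : Real.exp (-(2 * K₀ * (b - q))) * Real.exp (2 * K₀ * (b - q)) = 1 := by
      rw [← Real.exp_add]; simp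
    have h3 : 0 < Real.exp (-(2 * K₀ * (b - q))) := Real.exp_pos _
    nlinarith [mul_nonneg hA0 (sub_nonneg.2 hE), mul_nonneg hM0 h3.le]
  have := hle s hs
  have h4 : M * Real.exp (2 * K₀ * (b - s)) ≤ 2 * A * Real.exp (2 * K₀ * (b - s)) := by
    gcongr
  nlinarith

/-- Backward solvability, with a constant control, on intervals of a fixed length. -/
lemma exists_isAdmissible_const (hf : Continuous fun p : En n × En m => f p.1 p.2) {K₁ : ℝ}
    (hK₁ : 0 < K₁) (hA2 : ∀ x₁ x₂ u, u ∈ U → ‖f x₂ u - f x₁ u‖ ≤ K₁ * ‖x₂ - x₁‖)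
    {v : En m} (hv : v ∈ U) (hab : a ≤ b) (hlen : b - a ≤ 1 / (1 + K₁)) (x : En n) :
    ∃ γ, IsAdmissible f U a b (fun _ => v) γ ∧ γ b = x := by
  set ρ : ℝ := ‖f x v‖ + 1 with hρ
  have hρ0 : 0 < ρ := by positivity
  have hpl : IsPicardLindelof (fun _ : ℝ => fun y => f y v) (⟨b, hab, le_rfl⟩ : Icc a b) x
      ⟨ρ, hρ0.le⟩ 0 ⟨(1 + K₁) * ρ, by positivity⟩ ⟨K₁, hK₁.le⟩ := by
    refine IsPicardLindelof.of_time_independent ?_ ?_ ?_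
    · intro y hy
      have hy' : ‖y - x‖ ≤ ρ := by rw [← dist_eq_norm]; exact hy
      have h1 := hA2 x y v hv
      have h2 : ‖f y v‖ ≤ ‖f x v‖ + ‖f y v - f x v‖ := by
        have := norm_add_le (f x v) (f y v - f x v)
        simpa using this
      have h3 : K₁ * ‖y - x‖ ≤ K₁ * ρ := by gcongr
      change ‖f y v‖ ≤ (1 + K₁) * ρ
      linarith
    · refine LipschitzOnWith.of_dist_le_mul fun y _ z _ => ?_
      rw [dist_eq_norm, dist_eq_norm]
      exact hA2 z y v hv
    · change (1 + K₁) * ρ * max (b - b) (b - a) ≤ ρ - 0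
      rw [sub_self, max_eq_right (by linarith), sub_zero]
      rw [le_div_iff₀ (by positivity)] at hlen
      nlinarith
  obtain ⟨γ, hγb, hγ⟩ := hpl.exists_eq_forall_mem_Icc_hasDerivWithinAt₀
  have hcont : ContinuousOn γ (Icc a b) := fun s hs => (hγ s hs).continuousWithinAt
  refine ⟨γ, ⟨measurable_const, fun _ _ => hv, hcont, fun s hs => ?_⟩, hγb⟩
  have hfc : Continuous fun y => f y v := hf.comp (continuous_id.prodMk continuous_const)
  have hcont' : ContinuousOn γ (Icc a s) := hcont.mono (Icc_subset_Icc le_rfl hs.2)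
  have hint : IntervalIntegrable (fun r => f (γ r) v) volume a s := by
    refine ContinuousOn.intervalIntegrable ?_
    rw [uIcc_of_le hs.1]
    exact hfc.comp_continuousOn hcont'
  rw [intervalIntegral.integral_eq_sub_of_hasDerivAt_of_le hs.1 hcont'
    (fun r hr => (hγ r ⟨hr.1.le, hr.2.le.trans hs.2⟩).hasDerivAt
      (Icc_mem_nhds hr.1 (hr.2.trans_le hs.2))) hint, add_sub_cancel]

end Trajectories

/-- Inf-convolution in time and space of a bounded uniformly continuous function on a strip. -/
lemma exists_infConvolution {n : ℕ} {T η : ℝ} {w : ℝ → En n → ℝ}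
    (hbd : ∃ C : ℝ, ∀ t ∈ Icc (0 : ℝ) T, ∀ x, |w t x| ≤ C)
    (huc : UniformContinuousOn (fun p : ℝ × En n => w p.1 p.2) (Icc (0 : ℝ) T ×ˢ univ))
    (hη : 0 < η) :
    ∃ κ > 0, ∃ F : ℝ → En n → ℝ,
      (∀ t ∈ Icc (0 : ℝ) T, ∀ x, F t x ≤ w t x ∧ w t x - η ≤ F t x) ∧
      ∀ t ∈ Icc (0 : ℝ) T, ∀ x, ∃ s ∈ Icc (0 : ℝ) T, ∃ y, |t - s| ≤ η ∧ ‖x - y‖ ≤ η ∧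
        κ * ‖x - y‖ ^ 2 ≤ η ∧ F t x = w s y + κ * (‖x - y‖ ^ 2 + (t - s) ^ 2) ∧
        (∀ t' ∈ Icc (0 : ℝ) T, ∀ x', F t' x' ≤ w s y + κ * (‖x' - y‖ ^ 2 + (t' - s) ^ 2)) ∧
        ∀ s' ∈ Icc (0 : ℝ) T, ∀ y', w s y + κ * (‖x - y‖ ^ 2 + (t - s) ^ 2) ≤
          w s' y' + κ * (‖x - y'‖ ^ 2 + (t - s') ^ 2) := by
  obtain ⟨C, hC⟩ := hbd
  obtain ⟨δ, hδ, hδw⟩ := Metric.uniformContinuousOn_iff.1 huc η hη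
  set ρ := min δ η with hρdef
  have hρ : 0 < ρ := lt_min hδ hη
  set κ := (2 * |C| + 1) / ρ ^ 2 with hκdef
  have hκ : 0 < κ := by positivity
  have hκρ : κ * ρ ^ 2 = 2 * |C| + 1 := by rw [hκdef]; field_simp
  have hCC : C ≤ |C| := le_abs_self C
  set P : ℝ × En n → ℝ × En n → ℝ :=
    fun p q => w q.1 q.2 + κ * (‖p.2 - q.2‖ ^ 2 + (p.1 - q.1) ^ 2) with hP
  have key : ∀ p : ℝ × En n, p.1 ∈ Icc (0 : ℝ) T → ∃ q : ℝ × En n, q.1 ∈ Icc (0 : ℝ) T ∧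
      ∀ q' : ℝ × En n, q'.1 ∈ Icc (0 : ℝ) T → P p q ≤ P p q' := by
    intro p hp
    have hK : IsCompact (Icc (0 : ℝ) T ×ˢ Metric.closedBall p.2 ρ) :=
      isCompact_Icc.prod (isCompact_closedBall _ _)
    have hPc : ContinuousOn (P p) (Icc (0 : ℝ) T ×ˢ Metric.closedBall p.2 ρ) := by
      have h1 : ContinuousOn (fun q : ℝ × En n => w q.1 q.2)
          (Icc (0 : ℝ) T ×ˢ Metric.closedBall p.2 ρ) :=
        huc.continuousOn.mono (prod_mono_right (subset_univ _))
      exact h1.add (by fun_prop)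
    obtain ⟨q, hq, hmin⟩ := hK.exists_isMinOn ⟨p, hp, Metric.mem_closedBall_self hρ.le⟩ hPc
    refine ⟨q, hq.1, fun q' hq' => ?_⟩
    by_cases hb : q'.2 ∈ Metric.closedBall p.2 ρ
    · exact hmin ⟨hq', hb⟩
    · have h1 : P p q ≤ P p p := hmin ⟨hp, Metric.mem_closedBall_self hρ.le⟩
      have h2 : P p p = w p.1 p.2 := by simp [hP]
      have h3 := (abs_le.1 (hC p.1 hp p.2)).2
      have h4 := (abs_le.1 (hC q'.1 hq' q'.2)).1
      have h5 : ρ < ‖p.2 - q'.2‖ := by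
        rw [Metric.mem_closedBall, dist_comm, dist_eq_norm] at hb
        exact not_le.1 hb
      have h6 : κ * ρ ^ 2 ≤ κ * (‖p.2 - q'.2‖ ^ 2 + (p.1 - q'.1) ^ 2) := by
        have : ρ ^ 2 ≤ ‖p.2 - q'.2‖ ^ 2 := by gcongr
        have := sq_nonneg (p.1 - q'.1)
        gcongr
        linarith
      have h7 : P p q' = w q'.1 q'.2 + κ * (‖p.2 - q'.2‖ ^ 2 + (p.1 - q'.1) ^ 2) := rfl
      linarith
  choose! q hq hqmin using key
  have hmain : ∀ t ∈ Icc (0 : ℝ) T, ∀ x : En n,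
      κ * (‖x - (q (t, x)).2‖ ^ 2 + (t - (q (t, x)).1) ^ 2) ≤ η ∧
      |t - (q (t, x)).1| ≤ η ∧ ‖x - (q (t, x)).2‖ ≤ η ∧
      w t x - η ≤ w (q (t, x)).1 (q (t, x)).2 := by
    intro t ht x
    have h1 : P (t, x) (q (t, x)) ≤ P (t, x) (t, x) := hqmin (t, x) ht (t, x) ht
    have h2 : P (t, x) (t, x) = w t x := by simp [hP]
    have hqt : (q (t, x)).1 ∈ Icc (0 : ℝ) T := hq (t, x) ht
    generalize q (t, x) = z at h1 hqt ⊢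
    have h3 := (abs_le.1 (hC t ht x)).2
    have h4 := (abs_le.1 (hC z.1 hqt z.2)).1
    have h7 : P (t, x) z = w z.1 z.2 + κ * (‖x - z.2‖ ^ 2 + (t - z.1) ^ 2) := rfl
    have h8 : κ * (‖x - z.2‖ ^ 2 + (t - z.1) ^ 2) < κ * ρ ^ 2 := by linarith
    have h9 := lt_of_mul_lt_mul_left h8 hκ.le
    have h10 : ‖x - z.2‖ < ρ := lt_of_pow_lt_pow_left₀ 2 hρ.le (by nlinarith)
    have h11 : |t - z.1| < ρ := by
      refine lt_of_pow_lt_pow_left₀ 2 hρ.le ?_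
      rw [sq_abs]
      nlinarith [sq_nonneg ‖x - z.2‖]
    have h12 : dist (w t x) (w z.1 z.2) < η := by
      refine hδw (t, x) ⟨ht, trivial⟩ z ⟨hqt, trivial⟩ ?_
      rw [Prod.dist_eq, max_lt_iff, Real.dist_eq, dist_eq_norm]
      exact ⟨h11.trans_le (min_le_left _ _), h10.trans_le (min_le_left _ _)⟩
    rw [Real.dist_eq, abs_lt] at h12
    exact ⟨by linarith, h11.le.trans (min_le_right _ _), h10.le.trans (min_le_right _ _),
      by linarith⟩
  refine ⟨κ, hκ, fun t x => P (t, x) (q (t, x)), fun t ht x => ⟨?_, ?_⟩, fun t ht x => ?_⟩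
  · have := hqmin (t, x) ht (t, x) ht
    simpa [hP] using this
  · obtain ⟨-, -, -, h⟩ := hmain t ht x
    refine h.trans ?_
    simp only [hP]
    have : 0 ≤ κ * (‖x - (q (t, x)).2‖ ^ 2 + (t - (q (t, x)).1) ^ 2) := by positivity
    linarith
  · obtain ⟨h1, h2, h3, -⟩ := hmain t ht x
    refine ⟨(q (t, x)).1, hq (t, x) ht, (q (t, x)).2, h2, h3, ?_, rfl, fun t' ht' x' => ?_,
      fun s' hs' y' => ?_⟩
    · refine le_trans ?_ h1
      gcongr
      nlinarith [sq_nonneg (t - (q (t, x)).1)]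
    · exact hqmin (t', x') ht' (q (t, x)) (hq (t, x) ht)
    · exact hqmin (t, x) ht (s', y') hs'

section Penalty

variable {n m : ℕ}

lemma contDiff_quadratic (c t : ℝ) (x : En n) :
    ContDiff ℝ 1 (fun p : ℝ × En n => c * (‖x - p.2‖ ^ 2 + (t - p.1) ^ 2)) := by
  have h : ContDiff ℝ 1 (fun p : ℝ × En n => x - p.2) := contDiff_const.sub contDiff_snd
  have h' : ContDiff ℝ 1 (fun p : ℝ × En n => t - p.1) := contDiff_const.sub contDiff_fst
  exact contDiff_const.mul ((h.norm_sq ℝ).add (h'.pow 2))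

lemma deriv_quadratic (c t s : ℝ) (x y : En n) :
    deriv (fun τ : ℝ => c * (‖x - y‖ ^ 2 + (t - τ) ^ 2)) s = -(2 * c * (t - s)) := by
  have h : HasDerivAt (fun τ : ℝ => c * (‖x - y‖ ^ 2 + (t - τ) ^ 2))
      (c * (0 + 2 * (t - s) ^ 1 * (0 - 1))) s :=
    ((hasDerivAt_const s (‖x - y‖ ^ 2)).add
      (((hasDerivAt_const s t).sub (hasDerivAt_id s)).pow 2)).const_mul c
  rw [h.deriv]; ring

lemma gradient_quadratic (c t s : ℝ) (x y : En n) :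
    gradient (fun z : En n => c * (‖x - z‖ ^ 2 + (t - s) ^ 2)) y = (-(2 * c)) • (x - y) := by
  have h1 : HasFDerivAt (fun z : En n => x - z) (-(ContinuousLinearMap.id ℝ (En n))) y :=
    (hasFDerivAt_id y).const_sub x
  have h := ((h1.norm_sq).add_const ((t - s) ^ 2)).const_mul c
  refine HasGradientAt.gradient ?_
  rw [hasGradientAt_iff_hasFDerivAt]
  refine h.congr_fderiv ?_
  ext z
  simp
  ring

variable {T κ t : ℝ} {f : En n → En m → En n} {U : Set (En m)} {L : En n → En m → ℝ → ℝ}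
  {W : ℝ → En n → ℝ} {x y : En n} {s : ℝ}

lemma strip_mem_nhds (hs : s ∈ Ioo (0 : ℝ) T) (y : En n) :
    {p : ℝ × En n | p.1 ∈ Icc (0 : ℝ) T} ∈ nhds (s, y) :=
  continuous_fst.continuousAt.preimage_mem_nhds (Icc_mem_nhds hs.1 hs.2)

lemma exists_control_of_supersolution (hUne : U.Nonempty)
    (hsup : ∀ φ : ℝ → En n → ℝ, ContDiff ℝ 1 (fun p : ℝ × En n => φ p.1 p.2) →
      ∀ t₀ ∈ Ioo (0:ℝ) T, ∀ x₀ : En n,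
      IsLocalMin (fun p : ℝ × En n => W p.1 p.2 - φ p.1 p.2) (t₀, x₀) →
      deriv (fun τ => φ τ x₀) t₀ + ham f U L x₀ (gradient (φ t₀) x₀) t₀ ≥ 0)
    (hs : s ∈ Ioo (0 : ℝ) T)
    (hmin : ∀ s' ∈ Icc (0 : ℝ) T, ∀ y', W s y + κ * (‖x - y‖ ^ 2 + (t - s) ^ 2) ≤
          W s' y' + κ * (‖x - y'‖ ^ 2 + (t - s') ^ 2)) {e : ℝ} (he : 0 < e) :
    ∃ v ∈ U, -e ≤ 2 * κ * (t - s) + 2 * κ * ⟪x - y, f y v⟫ - L y v s := by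
  have h := hsup (fun τ z => (-κ) * (‖x - z‖ ^ 2 + (t - τ) ^ 2)) (contDiff_quadratic _ _ _) s hs y
    (by
      filter_upwards [strip_mem_nhds hs y] with p hp
      have := hmin p.1 hp p.2
      linarith)
  rw [deriv_quadratic, gradient_quadratic, ham] at h
  obtain ⟨v₀, hv₀⟩ := hUne
  obtain ⟨_, ⟨v, hv, rfl⟩, hlt⟩ := exists_lt_of_lt_csSup
    (s := {r | ∃ u ∈ U, r = ⟪-(2 * -κ) • (x - y), f y u⟫ - L y u s}) ⟨_, v₀, hv₀, rfl⟩
    (b := -(2 * κ * (t - s)) - e) (by linarith)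
  refine ⟨v, hv, ?_⟩
  rw [real_inner_smul_left] at hlt
  linarith

lemma le_of_subsolution (hU : IsCompact U)
    (hf : Continuous fun p : En n × En m => f p.1 p.2)
    (hL : Continuous fun p : En n × En m × ℝ => L p.1 p.2.1 p.2.2)
    (hsub : ∀ φ : ℝ → En n → ℝ, ContDiff ℝ 1 (fun p : ℝ × En n => φ p.1 p.2) →
      ∀ t₀ ∈ Ioo (0:ℝ) T, ∀ x₀ : En n,
      IsLocalMax (fun p : ℝ × En n => W p.1 p.2 - φ p.1 p.2) (t₀, x₀) →
      deriv (fun τ => φ τ x₀) t₀ + ham f U L x₀ (gradient (φ t₀) x₀) t₀ ≤ 0)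
    (hs : s ∈ Ioo (0 : ℝ) T)
    (hmin : ∀ s' ∈ Icc (0 : ℝ) T, ∀ y', -W s y + κ * (‖x - y‖ ^ 2 + (t - s) ^ 2) ≤
          -W s' y' + κ * (‖x - y'‖ ^ 2 + (t - s') ^ 2)) {v : En m} (hv : v ∈ U) :
    2 * (-κ) * (t - s) + 2 * (-κ) * ⟪x - y, f y v⟫ - L y v s ≤ 0 := by
  have h := hsub (fun τ z => κ * (‖x - z‖ ^ 2 + (t - τ) ^ 2)) (contDiff_quadratic _ _ _) s hs y
    (by
      filter_upwards [strip_mem_nhds hs y] with p hp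
      have := hmin p.1 hp p.2
      linarith)
  rw [deriv_quadratic, gradient_quadratic, ham] at h
  have hcont : Continuous fun v : En m => ⟪-(2 * κ) • (x - y), f y v⟫ - L y v s := by
    have h1 : Continuous fun v : En m => f y v := hf.comp (continuous_const.prodMk continuous_id)
    have h2 : Continuous fun v : En m => L y v s :=
      hL.comp (continuous_const.prodMk (continuous_id.prodMk continuous_const))
    exact (continuous_const.inner h1).sub h2
  have hbdd : BddAbove {r | ∃ u ∈ U, r = ⟪-(2 * κ) • (x - y), f y u⟫ - L y u s} := by
    refine (hU.bddAbove_image hcont.continuousOn).mono ?_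
    rintro _ ⟨u, hu, rfl⟩
    exact ⟨u, hu, rfl⟩
  have h3 := le_csSup hbdd ⟨v, hv, rfl⟩
  rw [real_inner_smul_left] at h3
  linarith

end Penalty

section Step

variable {n m : ℕ} {f : En n → En m → En n} {U : Set (En m)} {L : En n → En m → ℝ → ℝ}

set_option maxHeartbeats 800000 in
/-- The quadratic penalty along a short trajectory piece changes by the frozen Hamiltonian
integrand and the running cost, up to an error which is small relative to the time step. -/
lemma exists_step_bound (hU : IsCompact U) (hf : Continuous fun p : En n × En m => f p.1 p.2)
    {K₁ : ℝ} (hK₁ : 0 < K₁) (hA2 : ∀ x₁ x₂ u, u ∈ U → ‖f x₂ u - f x₁ u‖ ≤ K₁ * ‖x₂ - x₁‖)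
    (hL : Continuous fun p : En n × En m × ℝ => L p.1 p.2.1 p.2.2) (T R : ℝ) {e : ℝ} (he : 0 < e) :
    ∃ η₀ > 0, ∀ η ≤ η₀, ∀ κ : ℝ, ∃ h₀ > 0, ∀ (a b : ℝ) (u : ℝ → En m)
      (γ : ℝ → En n) (s : ℝ) (y : En n), 0 ≤ a → a ≤ b → b ≤ T → b - a ≤ h₀ →
      IsAdmissible f U a b u γ → (∀ r ∈ Icc a b, ‖γ r‖ ≤ R) → s ∈ Icc (0 : ℝ) T →
      |b - s| ≤ η → ‖γ b - y‖ ≤ η → |κ| * ‖γ b - y‖ ^ 2 ≤ η →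
      |κ * (‖γ a - y‖ ^ 2 + (a - s) ^ 2) - κ * (‖γ b - y‖ ^ 2 + (b - s) ^ 2)
        + (∫ r in a..b, L (γ r) (u r) r)
        + ∫ r in a..b, (2 * κ * (b - s) + 2 * κ * ⟪γ b - y, f y (u r)⟫ - L y (u r) s)|
        ≤ (b - a) * e := by
  have hK : IsCompact (Metric.closedBall (0 : En n) (R + 1) ×ˢ U ×ˢ Icc (0 : ℝ) T) :=
    (isCompact_closedBall _ _).prod (hU.prod isCompact_Icc)
  obtain ⟨δ, hδ, hLδ⟩ := Metric.uniformContinuousOn_iff.1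
    (hK.uniformContinuousOn_of_continuous hL.continuousOn) (e / 4) (by positivity)
  obtain ⟨M', hM'⟩ := ((isCompact_closedBall (0 : En n) (R + 1)).prod hU).exists_bound_of_continuousOn
    hf.continuousOn
  set M := |M'| with hMdef
  have hM0 : 0 ≤ M := abs_nonneg _
  have hM : ∀ z : En n, ‖z‖ ≤ R + 1 → ∀ v ∈ U, ‖f z v‖ ≤ M := fun z hz v hv =>
    (hM' (z, v) ⟨mem_closedBall_zero_iff.2 hz, hv⟩).trans (le_abs_self _)
  refine ⟨min 1 (min (δ / 3) (e / (8 * K₁))), by positivity, fun η hη κ => ?_⟩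
  obtain ⟨hη1, hη2, hη3⟩ : η ≤ 1 ∧ η ≤ δ / 3 ∧ η ≤ e / (8 * K₁) := by
    simpa only [le_min_iff] using hη
  refine ⟨min (δ / 3 / (M + 1)) (min (e / 4 / (|κ| * (M ^ 2 + 1) + 1))
    (e / 4 / (2 * |κ| * K₁ * M + 1))), by positivity, ?_⟩
  intro a b u γ s y ha hab hbT hh hadm hR hs hbs hby hκ
  obtain ⟨hh1, hh3, hh4⟩ : b - a ≤ δ / 3 / (M + 1) ∧
      b - a ≤ e / 4 / (|κ| * (M ^ 2 + 1) + 1) ∧ b - a ≤ e / 4 / (2 * |κ| * K₁ * M + 1) := by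
    simpa only [le_min_iff] using hh
  set h := b - a with hhdef
  have hh0 : 0 ≤ h := sub_nonneg.2 hab
  rw [le_div_iff₀ (by positivity)] at hh1 hh3 hh4 hη3
  have hκ0 := abs_nonneg κ
  have hMh : 0 ≤ M * h := mul_nonneg hM0 hh0
  have haI : a ∈ Icc a b := ⟨le_rfl, hab⟩
  have hbI : b ∈ Icc a b := ⟨hab, le_rfl⟩
  have hyR : ‖y‖ ≤ R + 1 := by
    have h1 := norm_sub_le (γ b) (γ b - y)
    rw [sub_sub_cancel] at h1
    have := hR b hbI
    linarith
  have hmove : ∀ r ∈ Icc a b, ‖γ b - γ r‖ ≤ M * h := by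
    intro r hr
    refine (hadm.norm_displacement_le hU hf (fun q hq => hM _ ((hR q hq).trans (by linarith)) _
      (hadm.2.1 q hq)) hr.1 hr.2 le_rfl).trans ?_
    have := hr.1
    gcongr
    linarith
  have hdist : ∀ r ∈ Icc a b, ‖γ r - y‖ ≤ M * h + ‖γ b - y‖ := by
    intro r hr
    have h1 : γ r - y = (γ b - y) - (γ b - γ r) := by abel
    rw [h1]
    have := norm_sub_le (γ b - y) (γ b - γ r)
    linarith [hmove r hr]
  set p := γ b - y with hp
  set d := γ b - γ a with hd
  have hda : γ a - y = p - d := by rw [hp, hd]; abel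
  have hdint : ⟪p, d⟫ = ∫ r in a..b, ⟪p, f (γ r) (u r)⟫ := by
    rw [hd, hadm.sub_eq_integral hU hf haI hbI]
    exact ((innerSL ℝ p).intervalIntegral_comp_comm
      (hadm.intervalIntegrable_velocity hU hf haI hbI)).symm
  have i1 : IntervalIntegrable (fun r => L (γ r) (u r) r) volume a b :=
    hadm.intervalIntegrable_comp hU hL haI hbI
  have i2 : IntervalIntegrable (fun r => ⟪p, f (γ r) (u r)⟫) volume a b :=
    hadm.intervalIntegrable_comp hU (G := fun q => ⟪p, f q.1 q.2.1⟫)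
      (continuous_const.inner
        (hf.comp (continuous_fst.prodMk (continuous_fst.comp continuous_snd)))) haI hbI
  have i3 : IntervalIntegrable
      (fun r => 2 * κ * (b - s) + 2 * κ * ⟪p, f y (u r)⟫ - L y (u r) s) volume a b := by
    refine hadm.intervalIntegrable_comp hU
      (G := fun q => 2 * κ * (b - s) + 2 * κ * ⟪p, f y q.2.1⟫ - L y q.2.1 s) ?_ haI hbI
    have h1 : Continuous fun q : En n × En m × ℝ => f y q.2.1 :=
      hf.comp (continuous_const.prodMk (continuous_fst.comp continuous_snd))
    have h2 : Continuous fun q : En n × En m × ℝ => L y q.2.1 s :=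
      hL.comp (continuous_const.prodMk
        ((continuous_fst.comp continuous_snd).prodMk continuous_const))
    exact (continuous_const.add (continuous_const.mul (continuous_const.inner h1))).sub h2
  have hsum : κ * (‖γ a - y‖ ^ 2 + (a - s) ^ 2) - κ * (‖p‖ ^ 2 + (b - s) ^ 2)
        + (∫ r in a..b, L (γ r) (u r) r)
        + ∫ r in a..b, (2 * κ * (b - s) + 2 * κ * ⟪p, f y (u r)⟫ - L y (u r) s)
      = (∫ r in a..b, (L (γ r) (u r) r
          + (2 * κ * (b - s) + 2 * κ * ⟪p, f y (u r)⟫ - L y (u r) s)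
          - (2 * κ * ⟪p, f (γ r) (u r)⟫ + 2 * κ * (b - s))))
        + κ * (‖d‖ ^ 2 + h ^ 2) := by
    rw [intervalIntegral.integral_sub (i1.add i3) ((i2.const_mul _).add intervalIntegrable_const),
      intervalIntegral.integral_add i1 i3,
      intervalIntegral.integral_add (i2.const_mul _) intervalIntegrable_const,
      intervalIntegral.integral_const_mul, ← hdint, intervalIntegral.integral_const, hda,
      norm_sub_sq_real, smul_eq_mul, ← hhdef]
    have : a = b - h := by rw [hhdef]; ring
    rw [this]
    ring
  rw [hsum]
  have hI : |∫ r in a..b, (L (γ r) (u r) r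
          + (2 * κ * (b - s) + 2 * κ * ⟪p, f y (u r)⟫ - L y (u r) s)
          - (2 * κ * ⟪p, f (γ r) (u r)⟫ + 2 * κ * (b - s)))| ≤ (3 * (e / 4)) * |b - a| := by
    rw [← Real.norm_eq_abs]
    refine intervalIntegral.norm_integral_le_of_norm_le_const fun r hr => ?_
    rw [uIoc_of_le hab] at hr
    have hr' : r ∈ Icc a b := ⟨hr.1.le, hr.2⟩
    have hur := hadm.2.1 r hr'
    have e1 : |L (γ r) (u r) r - L y (u r) s| < e / 4 := by
      rw [← Real.dist_eq]
      refine hLδ (γ r, u r, r)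
        ⟨mem_closedBall_zero_iff.2 ((hR r hr').trans (by linarith)), hur,
          ha.trans hr'.1, hr'.2.trans hbT⟩ (y, u r, s)
        ⟨mem_closedBall_zero_iff.2 hyR, hur, hs⟩ ?_
      rw [Prod.dist_eq, Prod.dist_eq, dist_self, dist_eq_norm, Real.dist_eq]
      simp only
      have h1 := hdist r hr'
      have h2 : |r - s| ≤ h + η := by
        have : r - s = (b - s) - (b - r) := by ring
        rw [this]
        refine (abs_sub _ _).trans ?_
        rw [abs_of_nonneg (sub_nonneg.2 hr'.2)]
        have := hr'.1
        linarith
      refine max_lt (by linarith) (max_lt hδ (by linarith))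
    have e2 : |⟪p, f y (u r) - f (γ r) (u r)⟫| ≤ ‖p‖ * (K₁ * (M * h + ‖p‖)) := by
      refine (abs_real_inner_le_norm _ _).trans ?_
      have h1 := hA2 (γ r) y (u r) hur
      have h2 := hdist r hr'
      rw [norm_sub_rev] at h2
      have h3 : K₁ * ‖y - γ r‖ ≤ K₁ * (M * h + ‖p‖) := by gcongr
      have := h1.trans h3
      gcongr
    have e3 : |2 * κ * ⟪p, f y (u r) - f (γ r) (u r)⟫| ≤ 2 * (e / 4) := by
      rw [abs_mul, abs_mul, abs_two]
      have h1 : 2 * |κ| * |⟪p, f y (u r) - f (γ r) (u r)⟫|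
          ≤ 2 * |κ| * (‖p‖ * (K₁ * (M * h + ‖p‖))) := by gcongr
      have h2 : 2 * |κ| * (‖p‖ * (K₁ * (M * h + ‖p‖)))
          = 2 * |κ| * K₁ * M * h * ‖p‖ + 2 * K₁ * (|κ| * ‖p‖ ^ 2) := by ring
      have h3 : 2 * |κ| * K₁ * M * h * ‖p‖ ≤ 2 * |κ| * K₁ * M * h * 1 := by
        have := hby.trans hη1
        gcongr
      have h4 : 2 * K₁ * (|κ| * ‖p‖ ^ 2) ≤ 2 * K₁ * η := by gcongr
      linarith
    rw [Real.norm_eq_abs]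
    have e4 : L (γ r) (u r) r
          + (2 * κ * (b - s) + 2 * κ * ⟪p, f y (u r)⟫ - L y (u r) s)
          - (2 * κ * ⟪p, f (γ r) (u r)⟫ + 2 * κ * (b - s))
        = (L (γ r) (u r) r - L y (u r) s) + 2 * κ * ⟪p, f y (u r) - f (γ r) (u r)⟫ := by
      rw [inner_sub_right]; ring
    rw [e4]
    refine (abs_add_le _ _).trans ?_
    linarith
  have hJ : |κ * (‖d‖ ^ 2 + h ^ 2)| ≤ h * (e / 4) := by
    rw [abs_mul, abs_of_nonneg (by positivity : 0 ≤ ‖d‖ ^ 2 + h ^ 2)]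
    have h1 : ‖d‖ ^ 2 ≤ (M * h) ^ 2 := by
      have := hmove a haI
      gcongr
    have h2 : |κ| * (‖d‖ ^ 2 + h ^ 2) ≤ |κ| * ((M * h) ^ 2 + h ^ 2) := by gcongr
    have h3 : |κ| * ((M * h) ^ 2 + h ^ 2) = h * (h * (|κ| * (M ^ 2 + 1))) := by ring
    have h4 : h * (|κ| * (M ^ 2 + 1)) ≤ e / 4 := by linarith
    have h5 : h * (h * (|κ| * (M ^ 2 + 1))) ≤ h * (e / 4) := by gcongr
    linarith
  rw [← hhdef, abs_of_nonneg hh0] at hI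
  refine (abs_add_le _ _).trans ?_
  linarith

end Step

lemma backward_induction {Q : ℝ → Prop} {τ b h₀ : ℝ} (hh₀ : 0 < h₀) (hτb : τ ≤ b) (hb : Q b)
    (hstep : ∀ a c, τ ≤ a → a ≤ c → c ≤ b → c - a ≤ h₀ → Q c → Q a) : Q τ := by
  have key : ∀ k : ℕ, Q (max τ (b - k * h₀)) := by
    intro k
    induction k with
    | zero => simpa [hτb] using hb
    | succ k ih =>
      refine hstep _ _ (le_max_left _ _) ?_ ?_ ?_ ih
      · refine max_le_max le_rfl ?_
        push_cast
        linarith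
      · have : 0 ≤ k * h₀ := by positivity
        exact max_le hτb (by linarith)
      · push_cast
        rw [sub_le_iff_le_add]
        refine max_le ?_ ?_
        · have := le_max_left τ (b - (k + 1) * h₀)
          linarith
        · have := le_max_right τ (b - (k + 1) * h₀)
          linarith
  obtain ⟨k, hk⟩ := exists_nat_ge ((b - τ) / h₀)
  rw [div_le_iff₀ hh₀] at hk
  have := key k
  rwa [max_eq_left (by linarith)] at this

section Optimality

variable {n m : ℕ} {T K₀ K₁ : ℝ} {U : Set (En m)} {f : En n → En m → En n}
  {L : En n → En m → ℝ → ℝ} {W : ℝ → En n → ℝ}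

lemma integral_cost_congr {a b : ℝ} {u u₁ : ℝ → En m} {γ γ₁ : ℝ → En n} (hab : a ≤ b)
    (hu : EqOn u u₁ (Ico a b)) (hγ : EqOn γ γ₁ (Icc a b)) :
    ∫ r in a..b, L (γ r) (u r) r = ∫ r in a..b, L (γ₁ r) (u₁ r) r := by
  refine intervalIntegral.integral_congr_Ioo_of_le hab fun r hr => ?_
  rw [hu ⟨hr.1.le, hr.2⟩, hγ ⟨hr.1.le, hr.2.le⟩]

lemma exists_isAdmissible (hU : IsCompact U) (hUne : U.Nonempty)
    (hf : Continuous fun p : En n × En m => f p.1 p.2) (hK₁ : 0 < K₁)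
    (hA2 : ∀ x₁ x₂ u, u ∈ U → ‖f x₂ u - f x₁ u‖ ≤ K₁ * ‖x₂ - x₁‖) {a b : ℝ} (hab : a ≤ b)
    (x : En n) : ∃ u γ, IsAdmissible f U a b u γ ∧ γ b = x := by
  obtain ⟨v, hv⟩ := hUne
  refine backward_induction (h₀ := 1 / (1 + K₁)) (Q := fun a => ∃ u γ, IsAdmissible f U a b u γ ∧
    γ b = x) (by positivity) hab ⟨_, _, isAdmissible_self b x hv, rfl⟩ ?_
  rintro a' c - hac hcb hlen ⟨u₂, γ₂, h₂, hb₂⟩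
  obtain ⟨γ₁, h₁, hc₁⟩ := exists_isAdmissible_const hf hK₁ hA2 hv hac hlen (γ₂ c)
  obtain ⟨u, γ, h, -, -, -, e4⟩ := h₁.concat h₂ hU hf hac hcb hc₁
  exact ⟨u, γ, h, by rw [e4 ⟨hcb, le_rfl⟩, hb₂]⟩

/-- A subsolution increases along trajectories at most at the rate of the running cost. -/
lemma le_add_integral_of_subsolution (hU : IsCompact U)
    (hf : Continuous fun p : En n × En m => f p.1 p.2) (hK₁ : 0 < K₁)
    (hA2 : ∀ x₁ x₂ u, u ∈ U → ‖f x₂ u - f x₁ u‖ ≤ K₁ * ‖x₂ - x₁‖)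
    (hL : Continuous fun p : En n × En m × ℝ => L p.1 p.2.1 p.2.2)
    (hWbd : ∃ C : ℝ, ∀ t ∈ Icc (0:ℝ) T, ∀ x, |W t x| ≤ C)
    (hWuc : UniformContinuousOn (fun p : ℝ × En n => W p.1 p.2) (Icc (0:ℝ) T ×ˢ univ))
    (hsub : ∀ φ : ℝ → En n → ℝ, ContDiff ℝ 1 (fun p : ℝ × En n => φ p.1 p.2) →
      ∀ t₀ ∈ Ioo (0:ℝ) T, ∀ x₀ : En n,
      IsLocalMax (fun p : ℝ × En n => W p.1 p.2 - φ p.1 p.2) (t₀, x₀) →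
      deriv (fun τ => φ τ x₀) t₀ + ham f U L x₀ (gradient (φ t₀) x₀) t₀ ≤ 0)
    {τ b : ℝ} (hτ : 0 < τ) (hτb : τ ≤ b) (hbT : b < T) {u : ℝ → En m} {γ : ℝ → En n}
    (hadm : IsAdmissible f U τ b u γ) :
    W b (γ b) ≤ W τ (γ τ) + ∫ r in τ..b, L (γ r) (u r) r := by
  refine le_of_forall_pos_le_add fun e he => ?_
  obtain ⟨R, hR⟩ := isCompact_Icc.exists_bound_of_continuousOn hadm.2.2.1
  set e' := e / (2 * (b - τ + 1)) with he'
  have hbτ : 0 ≤ b - τ := sub_nonneg.2 hτb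
  have he'0 : 0 < e' := by positivity
  have he'e : (b - τ) * e' ≤ e / 2 := by
    rw [he', mul_div_assoc', div_le_div_iff₀ (by positivity) (by positivity)]
    nlinarith
  obtain ⟨η₀, hη₀, hstep⟩ := exists_step_bound hU hf hK₁ hA2 hL T R he'0
  set η := min (min η₀ (e / 2)) (min (τ / 2) ((T - b) / 2)) with hη
  have hTb : 0 < T - b := sub_pos.2 hbT
  have hη0 : 0 < η := by positivity
  obtain ⟨⟨hη1, hη2⟩, hη3, hη4⟩ : (η ≤ η₀ ∧ η ≤ e / 2) ∧ η ≤ τ / 2 ∧ η ≤ (T - b) / 2 := by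
    simpa only [le_min_iff] using hη.le
  obtain ⟨κ, hκ, F, hF1, hF2⟩ := exists_infConvolution (w := fun t x => -W t x)
    (by simpa only [abs_neg] using hWbd) (uniformContinuous_neg.comp_uniformContinuousOn hWuc) hη0
  obtain ⟨h₀, hh₀, hstep⟩ := hstep η hη1 (-κ)
  have hchain : F τ (γ τ) ≤ F b (γ b) + (∫ r in τ..b, L (γ r) (u r) r) + (b - τ) * e' := by
    refine backward_induction (Q := fun a => F a (γ a) ≤ F b (γ b) +
      (∫ r in a..b, L (γ r) (u r) r) + (b - a) * e') hh₀ hτb (by simp) ?_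
    intro a c hτa hac hcb hlen hQ
    have hcI : c ∈ Icc (0 : ℝ) T := ⟨by linarith, by linarith⟩
    obtain ⟨s, hs, y, hts, hxy, hκxy, hFeq, hFle, hmin⟩ := hF2 c hcI (γ c)
    rw [abs_le] at hts
    have hs' : s ∈ Ioo (0 : ℝ) T := ⟨by linarith, by linarith⟩
    have hac_adm := hadm.restrict hU hf hτa hcb
    have h1 := hstep a c u γ s y (by linarith) hac (by linarith) hlen hac_adm
      (fun r hr => hR r ⟨hτa.trans hr.1, hr.2.trans hcb⟩) hs (abs_le.2 hts) hxy
      (by rwa [abs_neg, abs_of_pos hκ])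
    have h2 : ∫ r in a..c, (2 * -κ * (c - s) + 2 * -κ * ⟪γ c - y, f y (u r)⟫ - L y (u r) s) ≤ 0 := by
      have : 0 ≤ ∫ r in a..c,
          -(2 * -κ * (c - s) + 2 * -κ * ⟪γ c - y, f y (u r)⟫ - L y (u r) s) := by
        refine intervalIntegral.integral_nonneg hac fun r hr => ?_
        have := le_of_subsolution hU hf hL hsub hs' hmin (hac_adm.2.1 r hr)
        linarith
      rw [intervalIntegral.integral_neg] at this
      linarith
    have h3 := hFle a ⟨by linarith, by linarith⟩ (γ a)
    have h4 := (abs_le.1 h1).1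
    have h5 : (∫ r in a..c, L (γ r) (u r) r) + (∫ r in c..b, L (γ r) (u r) r)
        = ∫ r in a..b, L (γ r) (u r) r := by
      refine intervalIntegral.integral_add_adjacent_intervals ?_ ?_
      · exact hadm.intervalIntegrable_comp hU hL ⟨hτa, hac.trans hcb⟩ ⟨hτa.trans hac, hcb⟩
      · exact hadm.intervalIntegrable_comp hU hL ⟨hτa.trans hac, hcb⟩ ⟨hτb, le_rfl⟩
    have h6 : (b - a) * e' = (c - a) * e' + (b - c) * e' := by ring
    rw [← h5, h6]
    linarith
  have h1 := (hF1 b ⟨by linarith, hbT.le⟩ (γ b)).1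
  have h2 := (hF1 τ ⟨hτ.le, by linarith⟩ (γ τ)).2
  linarith

/-- A supersolution is almost attained by the cost of some trajectory. -/
lemma exists_add_integral_le_of_supersolution (hU : IsCompact U) (hUne : U.Nonempty)
    (hf : Continuous fun p : En n × En m => f p.1 p.2) (hK₀ : 0 < K₀)
    (hA1 : ∀ x u, ‖f x u‖ ≤ K₀ * (1 + ‖x‖ + ‖u‖)) (hK₁ : 0 < K₁)
    (hA2 : ∀ x₁ x₂ u, u ∈ U → ‖f x₂ u - f x₁ u‖ ≤ K₁ * ‖x₂ - x₁‖)
    (hL : Continuous fun p : En n × En m × ℝ => L p.1 p.2.1 p.2.2)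
    (hWbd : ∃ C : ℝ, ∀ t ∈ Icc (0:ℝ) T, ∀ x, |W t x| ≤ C)
    (hWuc : UniformContinuousOn (fun p : ℝ × En n => W p.1 p.2) (Icc (0:ℝ) T ×ˢ univ))
    (hsup : ∀ φ : ℝ → En n → ℝ, ContDiff ℝ 1 (fun p : ℝ × En n => φ p.1 p.2) →
      ∀ t₀ ∈ Ioo (0:ℝ) T, ∀ x₀ : En n,
      IsLocalMin (fun p : ℝ × En n => W p.1 p.2 - φ p.1 p.2) (t₀, x₀) →
      deriv (fun τ => φ τ x₀) t₀ + ham f U L x₀ (gradient (φ t₀) x₀) t₀ ≥ 0)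
    {τ b : ℝ} (hτ : 0 < τ) (hτb : τ ≤ b) (hbT : b < T) (x : En n) {e : ℝ} (he : 0 < e) :
    ∃ u γ, IsAdmissible f U τ b u γ ∧ γ b = x ∧
      W τ (γ τ) + (∫ r in τ..b, L (γ r) (u r) r) ≤ W b x + e := by
  obtain ⟨B, hB0, hB⟩ := hU.isBounded.exists_pos_norm_le
  set R := 2 * Real.exp (2 * K₀ * T) * (1 + B + ‖x‖) with hRdef
  set e' := e / (4 * (b - τ + 1)) with he'
  have hbτ : 0 ≤ b - τ := sub_nonneg.2 hτb
  have he'0 : 0 < e' := by positivity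
  have he'e : (b - τ) * (2 * e') ≤ e / 2 := by
    rw [he', mul_div_assoc', mul_div_assoc', div_le_div_iff₀ (by positivity) (by positivity)]
    nlinarith
  obtain ⟨η₀, hη₀, hstep⟩ := exists_step_bound hU hf hK₁ hA2 hL T R he'0
  set η := min (min η₀ (e / 2)) (min (τ / 2) ((T - b) / 2)) with hη
  have hTb : 0 < T - b := sub_pos.2 hbT
  have hη0 : 0 < η := by positivity
  obtain ⟨⟨hη1, hη2⟩, hη3, hη4⟩ : (η ≤ η₀ ∧ η ≤ e / 2) ∧ η ≤ τ / 2 ∧ η ≤ (T - b) / 2 := by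
    simpa only [le_min_iff] using hη.le
  obtain ⟨κ, hκ, F, hF1, hF2⟩ := exists_infConvolution hWbd hWuc hη0
  obtain ⟨h₀, hh₀, hstep⟩ := hstep η hη1 κ
  obtain ⟨v₀, hv₀⟩ := hUne
  have hchain : ∃ u γ, IsAdmissible f U τ b u γ ∧ γ b = x ∧
      F τ (γ τ) + (∫ r in τ..b, L (γ r) (u r) r) ≤ F b x + (b - τ) * (2 * e') := by
    refine backward_induction (h₀ := min h₀ (1 / (1 + K₁))) (Q := fun a => ∃ u γ,
      IsAdmissible f U a b u γ ∧ γ b = x ∧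
      F a (γ a) + (∫ r in a..b, L (γ r) (u r) r) ≤ F b x + (b - a) * (2 * e'))
      (by positivity) hτb ⟨_, _, isAdmissible_self b x hv₀, rfl, by simp⟩ ?_
    rintro a c hτa hac hcb hlen ⟨u₂, γ₂, h₂, hγ₂b, hQ⟩
    have hcI : c ∈ Icc (0 : ℝ) T := ⟨by linarith, by linarith⟩
    obtain ⟨s, hs, y, hts, hxy, hκxy, hFeq, hFle, hmin⟩ := hF2 c hcI (γ₂ c)
    rw [abs_le] at hts
    have hs' : s ∈ Ioo (0 : ℝ) T := ⟨by linarith, by linarith⟩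
    obtain ⟨v, hv, hve⟩ := exists_control_of_supersolution ⟨v₀, hv₀⟩ hsup hs' hmin he'0
    obtain ⟨γ₁, h₁, hγ₁c⟩ := exists_isAdmissible_const hf hK₁ hA2 hv hac
      (hlen.trans (min_le_right _ _)) (γ₂ c)
    obtain ⟨u, γ, hadm, e1, e2, e3, e4⟩ := h₁.concat h₂ hU hf hac hcb hγ₁c
    have hγb : γ b = x := by rw [e4 ⟨hcb, le_rfl⟩, hγ₂b]
    have hR : ∀ r ∈ Icc a c, ‖γ₁ r‖ ≤ R := by
      intro r hr
      rw [← e2 hr]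
      refine (hadm.norm_le hU hf hK₀ hA1 hB hB0.le ⟨hr.1, hr.2.trans hcb⟩).trans ?_
      rw [hγb, hRdef]
      have := hr.1
      gcongr
      linarith
    have h1 := hstep a c _ γ₁ s y (by linarith) hac (by linarith) (hlen.trans (min_le_left _ _)) h₁
      hR hs (by rwa [abs_le]) (by rwa [hγ₁c]) (by rwa [abs_of_pos hκ, hγ₁c])
    rw [hγ₁c, intervalIntegral.integral_const, smul_eq_mul] at h1
    have h2 : -((c - a) * e') ≤ (c - a) *
        (2 * κ * (c - s) + 2 * κ * ⟪γ₂ c - y, f y v⟫ - L y v s) := by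
      have := mul_le_mul_of_nonneg_left hve (sub_nonneg.2 hac)
      linarith
    have h3 := hFle a ⟨by linarith, by linarith⟩ (γ₁ a)
    have h4 := (abs_le.1 h1).2
    have h5 : (∫ r in a..c, L (γ r) (u r) r) + (∫ r in c..b, L (γ r) (u r) r)
        = ∫ r in a..b, L (γ r) (u r) r := by
      refine intervalIntegral.integral_add_adjacent_intervals ?_ ?_
      · exact hadm.intervalIntegrable_comp hU hL ⟨le_rfl, hac.trans hcb⟩ ⟨hac, hcb⟩
      · exact hadm.intervalIntegrable_comp hU hL ⟨hac, hcb⟩ ⟨hac.trans hcb, le_rfl⟩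
    rw [integral_cost_congr hac e1 e2,
      integral_cost_congr hcb (e3.mono Ico_subset_Icc_self) e4] at h5
    refine ⟨u, γ, hadm, hγb, ?_⟩
    rw [← h5, e2 ⟨le_rfl, hac⟩]
    have h6 : (b - a) * (2 * e') = 2 * ((c - a) * e') + (b - c) * (2 * e') := by ring
    rw [h6]
    linarith
  obtain ⟨u, γ, hadm, hγb, hle⟩ := hchain
  refine ⟨u, γ, hadm, hγb, ?_⟩
  have h1 := (hF1 b ⟨by linarith, hbT.le⟩ x).1
  have h2 := (hF1 τ ⟨hτ.le, by linarith⟩ (γ τ)).2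
  linarith

end Optimality

section Comparison

variable {n m : ℕ} {T K₀ K₁ : ℝ} {U : Set (En m)} {f : En n → En m → En n}
  {L : En n → En m → ℝ → ℝ} {W : ℝ → En n → ℝ}

lemma le_add_integral_of_subsolution_Icc (hU : IsCompact U)
    (hf : Continuous fun p : En n × En m => f p.1 p.2) (hK₁ : 0 < K₁)
    (hA2 : ∀ x₁ x₂ u, u ∈ U → ‖f x₂ u - f x₁ u‖ ≤ K₁ * ‖x₂ - x₁‖)
    (hL : Continuous fun p : En n × En m × ℝ => L p.1 p.2.1 p.2.2)
    (hWbd : ∃ C : ℝ, ∀ t ∈ Icc (0:ℝ) T, ∀ x, |W t x| ≤ C)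
    (hWuc : UniformContinuousOn (fun p : ℝ × En n => W p.1 p.2) (Icc (0:ℝ) T ×ˢ univ))
    (hsub : ∀ φ : ℝ → En n → ℝ, ContDiff ℝ 1 (fun p : ℝ × En n => φ p.1 p.2) →
      ∀ t₀ ∈ Ioo (0:ℝ) T, ∀ x₀ : En n,
      IsLocalMax (fun p : ℝ × En n => W p.1 p.2 - φ p.1 p.2) (t₀, x₀) →
      deriv (fun τ => φ τ x₀) t₀ + ham f U L x₀ (gradient (φ t₀) x₀) t₀ ≤ 0)
    {t : ℝ} (ht : t ∈ Icc (0 : ℝ) T) {u : ℝ → En m} {γ : ℝ → En n}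
    (hadm : IsAdmissible f U 0 t u γ) :
    W t (γ t) ≤ (∫ r in (0:ℝ)..t, L (γ r) (u r) r) + W 0 (γ 0) := by
  rcases ht.1.eq_or_lt with h0 | h0
  · subst h0; simp
  have hint : ∀ {c d}, c ∈ Icc 0 t → d ∈ Icc 0 t →
      IntervalIntegrable (fun r => L (γ r) (u r) r) volume c d :=
    fun hc hd => hadm.intervalIntegrable_comp hU hL hc hd
  have hz : (0 : ℝ) ∈ Icc 0 t := ⟨le_rfl, h0.le⟩
  set Ψ : ℝ → ℝ := fun s => W s (γ s) - ∫ r in (0:ℝ)..s, L (γ r) (u r) r with hΨ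
  have hΨc : ContinuousOn Ψ (Icc 0 t) := by
    refine ContinuousOn.sub ?_ ?_
    · exact hWuc.continuousOn.comp (continuousOn_id.prodMk hadm.2.2.1)
        fun s hs => ⟨⟨hs.1, hs.2.trans ht.2⟩, mem_univ _⟩
    · have := hint hz ⟨h0.le, le_rfl⟩
      rw [intervalIntegrable_iff_integrableOn_Icc_of_le h0.le] at this
      have := intervalIntegral.continuousOn_primitive_interval (a := 0) (b := t) (by
        rwa [uIcc_of_le h0.le])
      rwa [uIcc_of_le h0.le] at this
  have h1 : ∀ b ∈ Ioo 0 t, ∀ τ ∈ Ioc 0 b, Ψ b ≤ Ψ τ := by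
    intro b hb τ hτ
    have := le_add_integral_of_subsolution hU hf hK₁ hA2 hL hWbd hWuc hsub hτ.1 hτ.2
      (hb.2.trans_le ht.2) (hadm.restrict hU hf hτ.1.le hb.2.le)
    have h2 := intervalIntegral.integral_add_adjacent_intervals
      (hint hz ⟨hτ.1.le, hτ.2.trans hb.2.le⟩)
      (hint ⟨hτ.1.le, hτ.2.trans hb.2.le⟩ ⟨hb.1.le, hb.2.le⟩)
    simp only [hΨ]
    linarith
  have h2 : ∀ b ∈ Ioo 0 t, Ψ b ≤ Ψ 0 := by
    intro b hb
    refine ContinuousWithinAt.closure_le (s := Ioc 0 b) (f := fun _ => Ψ b) ?_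
      continuousWithinAt_const
      ((hΨc 0 hz).mono fun s hs => ⟨hs.1.le, hs.2.trans hb.2.le⟩) (h1 b hb)
    rw [closure_Ioc hb.1.ne]
    exact ⟨le_rfl, hb.1.le⟩
  have h3 : Ψ t ≤ Ψ 0 := by
    refine ContinuousWithinAt.closure_le (s := Ioo 0 t) (g := fun _ => Ψ 0) ?_
      ((hΨc t ⟨h0.le, le_rfl⟩).mono Ioo_subset_Icc_self) continuousWithinAt_const h2
    rw [closure_Ioo h0.ne]
    exact ⟨h0.le, le_rfl⟩
  simp only [hΨ, intervalIntegral.integral_same] at h3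
  linarith

lemma exists_integral_add_le_of_supersolution_Icc (hU : IsCompact U) (hUne : U.Nonempty)
    (hf : Continuous fun p : En n × En m => f p.1 p.2) (hK₀ : 0 < K₀)
    (hA1 : ∀ x u, ‖f x u‖ ≤ K₀ * (1 + ‖x‖ + ‖u‖)) (hK₁ : 0 < K₁)
    (hA2 : ∀ x₁ x₂ u, u ∈ U → ‖f x₂ u - f x₁ u‖ ≤ K₁ * ‖x₂ - x₁‖)
    (hL : Continuous fun p : En n × En m × ℝ => L p.1 p.2.1 p.2.2)
    (hWbd : ∃ C : ℝ, ∀ t ∈ Icc (0:ℝ) T, ∀ x, |W t x| ≤ C)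
    (hWuc : UniformContinuousOn (fun p : ℝ × En n => W p.1 p.2) (Icc (0:ℝ) T ×ˢ univ))
    (hsup : ∀ φ : ℝ → En n → ℝ, ContDiff ℝ 1 (fun p : ℝ × En n => φ p.1 p.2) →
      ∀ t₀ ∈ Ioo (0:ℝ) T, ∀ x₀ : En n,
      IsLocalMin (fun p : ℝ × En n => W p.1 p.2 - φ p.1 p.2) (t₀, x₀) →
      deriv (fun τ => φ τ x₀) t₀ + ham f U L x₀ (gradient (φ t₀) x₀) t₀ ≥ 0)
    {t : ℝ} (ht : t ∈ Icc (0 : ℝ) T) (x : En n) {e : ℝ} (he : 0 < e) :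
    ∃ u γ, IsAdmissible f U 0 t u γ ∧ γ t = x ∧
      (∫ r in (0:ℝ)..t, L (γ r) (u r) r) + W 0 (γ 0) ≤ W t x + e := by
  rcases ht.1.eq_or_lt with h0 | h0
  · subst h0
    obtain ⟨v, hv⟩ := hUne
    exact ⟨_, _, isAdmissible_self 0 x hv, rfl, by simpa using he.le⟩
  obtain ⟨B, hB0, hB⟩ := hU.isBounded.exists_pos_norm_le
  set R := 2 * Real.exp (2 * K₀ * t) * (1 + B + ‖x‖) with hRdef
  have hBR : IsCompact (Metric.closedBall (0 : En n) R) := isCompact_closedBall _ _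
  obtain ⟨M', hM'⟩ := (hBR.prod hU).exists_bound_of_continuousOn hf.continuousOn
  obtain ⟨C', hC'⟩ := (hBR.prod (hU.prod (isCompact_Icc (a := (0:ℝ)) (b := t)))).exists_bound_of_continuousOn
    hL.continuousOn
  set e' := e / 5 with he'
  have he'0 : 0 < e' := by positivity
  obtain ⟨δ, hδ, hδW⟩ := Metric.uniformContinuousOn_iff.1 hWuc e' he'0
  set σ := min (t / 3) (min (δ / 2 / (1 + |M'|)) (e' / (1 + |C'|))) with hσdef
  have hσ0 : 0 < σ := by positivity
  obtain ⟨hσ1, hσ2, hσ3⟩ : σ ≤ t / 3 ∧ σ ≤ δ / 2 / (1 + |M'|) ∧ σ ≤ e' / (1 + |C'|) := by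
    simpa only [le_min_iff] using hσdef.le
  rw [le_div_iff₀ (by positivity)] at hσ2 hσ3
  obtain ⟨u₃, γ₃, h₃, hx₃⟩ := exists_isAdmissible hU hUne hf hK₁ hA2 (sub_le_self t hσ0.le) x
  obtain ⟨u₂, γ₂, h₂, hx₂, hle⟩ := exists_add_integral_le_of_supersolution hU hUne hf hK₀ hA1 hK₁
    hA2 hL hWbd hWuc hsup (τ := σ) (b := t - σ) hσ0 (by linarith) (by linarith [ht.2])
    (γ₃ (t - σ)) he'0
  obtain ⟨u₁, γ₁, h₁, hx₁⟩ := exists_isAdmissible hU hUne hf hK₁ hA2 hσ0.le (γ₂ σ)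
  obtain ⟨u', γ', h', eu₁, eγ₁, eu₂, eγ₂⟩ := h₁.concat h₂ hU hf hσ0.le (by linarith) hx₁
  obtain ⟨u, γ, hadm, eu', eγ', eu₃, eγ₃⟩ := h'.concat h₃ hU hf (by linarith)
    (sub_le_self t hσ0.le) ((eγ₂ ⟨by linarith, le_rfl⟩).trans hx₂)
  have hγt : γ t = x := (eγ₃ ⟨by linarith, le_rfl⟩).trans hx₃
  have hR : ∀ r ∈ Icc 0 t, ‖γ r‖ ≤ R := by
    intro r hr
    refine (hadm.norm_le hU hf hK₀ hA1 hB hB0.le hr).trans ?_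
    rw [hγt, hRdef]
    have := hr.1
    gcongr
    linarith
  have hsmall : ∀ c ∈ Icc 0 t, ∀ d ∈ Icc 0 t, c ≤ d → d - c ≤ σ →
      |∫ r in c..d, L (γ r) (u r) r| ≤ e' ∧ |W d (γ d) - W c (γ c)| < e' := by
    intro c hc d hd hcd hlen
    constructor
    · rw [← Real.norm_eq_abs]
      refine (intervalIntegral.norm_integral_le_of_norm_le_const (C := 1 + |C'|)
        fun r hr => ?_).trans ?_
      · rw [uIoc_of_le hcd] at hr
        have hr' : r ∈ Icc 0 t := ⟨hc.1.trans hr.1.le, hr.2.trans hd.2⟩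
        have := hC' (γ r, u r, r) ⟨mem_closedBall_zero_iff.2 (hR r hr'), hadm.2.1 r hr', hr'⟩
        exact this.trans ((le_abs_self _).trans (by linarith))
      · rw [abs_of_nonneg (sub_nonneg.2 hcd), mul_comm]
        exact (mul_le_mul_of_nonneg_right hlen (by positivity)).trans hσ3
    · rw [← Real.dist_eq]
      refine hδW (d, γ d) ⟨⟨hd.1, hd.2.trans ht.2⟩, mem_univ _⟩ (c, γ c)
        ⟨⟨hc.1, hc.2.trans ht.2⟩, mem_univ _⟩ ?_
      have hdis := hadm.norm_displacement_le hU hf (M := 1 + |M'|) (fun r hr =>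
        (hM' (γ r, u r) ⟨mem_closedBall_zero_iff.2 (hR r hr), hadm.2.1 r hr⟩).trans
          ((le_abs_self _).trans (by linarith))) hc.1 hcd hd.2
      have h1 : (1 + |M'|) * (d - c) ≤ (1 + |M'|) * σ := by gcongr
      have h2 : 0 ≤ |M'| * σ := by positivity
      rw [Prod.dist_eq, dist_eq_norm, dist_eq_norm, Real.norm_of_nonneg (sub_nonneg.2 hcd)]
      exact max_lt (by linarith) (by linarith)
  have hz : (0 : ℝ) ∈ Icc 0 t := ⟨le_rfl, h0.le⟩
  have hσI : σ ∈ Icc 0 t := ⟨hσ0.le, by linarith⟩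
  have hbI : t - σ ∈ Icc 0 t := ⟨by linarith, by linarith⟩
  have htI : t ∈ Icc 0 t := ⟨h0.le, le_rfl⟩
  obtain ⟨a1, a2⟩ := hsmall 0 hz σ hσI hσ0.le (by linarith)
  obtain ⟨a3, a4⟩ := hsmall (t - σ) hbI t htI (by linarith) (by linarith)
  have s1 := intervalIntegral.integral_add_adjacent_intervals
    (hadm.intervalIntegrable_comp hU hL hz hσI) (hadm.intervalIntegrable_comp hU hL hσI htI)
  have s2 := intervalIntegral.integral_add_adjacent_intervals
    (hadm.intervalIntegrable_comp hU hL hσI hbI) (hadm.intervalIntegrable_comp hU hL hbI htI)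
  have mid : ∫ r in σ..(t - σ), L (γ r) (u r) r = ∫ r in σ..(t - σ), L (γ₂ r) (u₂ r) r := by
    refine integral_cost_congr (by linarith) (fun r hr => ?_) fun r hr => ?_
    · rw [eu' ⟨hσ0.le.trans hr.1, hr.2⟩, eu₂ ⟨hr.1, hr.2.le⟩]
    · rw [eγ' ⟨hσ0.le.trans hr.1, hr.2⟩, eγ₂ hr]
  have gσ : γ σ = γ₂ σ := by
    rw [eγ' ⟨hσ0.le, by linarith⟩, eγ₂ ⟨le_rfl, by linarith⟩]
  have gb : γ (t - σ) = γ₃ (t - σ) := eγ₃ ⟨le_rfl, by linarith⟩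
  refine ⟨u, γ, hadm, hγt, ?_⟩
  rw [← gσ, ← gb, ← mid] at hle
  rw [hγt] at a4
  rw [abs_le] at a1 a3
  rw [abs_lt] at a2 a4
  dsimp only at s1 s2
  linarith

end Comparison

/-- Uniqueness of the viscosity solution: any bounded uniformly continuous
viscosity sub- and supersolution of the HJB equation with initial datum `I`
coincides with the value function. -/
theorem viscosity_solution_unique {n m : ℕ} (T : ℝ) (hT : 0 < T)
    (U : Set (En m)) (hU : IsCompact U) (hUne : U.Nonempty)
    (f : En n → En m → En n)
    (hf : Continuous fun p : En n × En m => f p.1 p.2)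
    (K₀ : ℝ) (hK₀ : 0 < K₀)
    (hA1 : ∀ x u, ‖f x u‖ ≤ K₀ * (1 + ‖x‖ + ‖u‖))
    (K₁ : ℝ) (hK₁ : 0 < K₁)
    (hA2 : ∀ x₁ x₂ u, u ∈ U → ‖f x₂ u - f x₁ u‖ ≤ K₁ * ‖x₂ - x₁‖)
    (L : En n → En m → ℝ → ℝ)
    (hL : Continuous fun p : En n × En m × ℝ => L p.1 p.2.1 p.2.2)
    (hL1 : ∀ K : ℝ, ∃ C : ℝ, ∀ x u t, u ∈ U → t ∈ Icc (0:ℝ) T →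
      K * ‖u‖ - C ≤ L x u t)
    (hL2 : ∀ R > (0:ℝ), ∃ α : ℝ, ∀ x₁ x₂ u t, ‖x₁‖ ≤ R → ‖x₂‖ ≤ R → u ∈ U →
      t ∈ Icc (0:ℝ) T → |L x₂ u t - L x₁ u t| ≤ α * ‖x₂ - x₁‖)
    (hLu : ∃ C : ℝ, ∀ x u₁ u₂ t, u₁ ∈ U → u₂ ∈ U → t ∈ Icc (0:ℝ) T →
      |L x u₁ t - L x u₂ t| ≤ C * ‖u₁ - u₂‖)
    (I : En n → ℝ) (hI : Continuous I) (hIbd : ∃ C : ℝ, ∀ x, |I x| ≤ C)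
    (W : ℝ → En n → ℝ)
    (hWbd : ∃ C : ℝ, ∀ t ∈ Icc (0:ℝ) T, ∀ x, |W t x| ≤ C)
    (hWuc : UniformContinuousOn (fun p : ℝ × En n => W p.1 p.2)
      (Icc (0:ℝ) T ×ˢ univ))
    (hsub : ∀ φ : ℝ → En n → ℝ, ContDiff ℝ 1 (fun p : ℝ × En n => φ p.1 p.2) →
      ∀ t₀ ∈ Ioo (0:ℝ) T, ∀ x₀ : En n,
      IsLocalMax (fun p : ℝ × En n => W p.1 p.2 - φ p.1 p.2) (t₀, x₀) →
      deriv (fun τ => φ τ x₀) t₀ + ham f U L x₀ (gradient (φ t₀) x₀) t₀ ≤ 0)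
    (hsup : ∀ φ : ℝ → En n → ℝ, ContDiff ℝ 1 (fun p : ℝ × En n => φ p.1 p.2) →
      ∀ t₀ ∈ Ioo (0:ℝ) T, ∀ x₀ : En n,
      IsLocalMin (fun p : ℝ × En n => W p.1 p.2 - φ p.1 p.2) (t₀, x₀) →
      deriv (fun τ => φ τ x₀) t₀ + ham f U L x₀ (gradient (φ t₀) x₀) t₀ ≥ 0)
    (hW0 : ∀ x, W 0 x = I x) :
    ∀ t ∈ Icc (0:ℝ) T, ∀ x, W t x = valueFun f U L I t x := by
  intro t ht x
  set S := { J | ∃ u γ, IsAdmissible f U 0 t u γ ∧ γ t = x ∧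
      J = (∫ s in (0:ℝ)..t, L (γ s) (u s) s) + I (γ 0) } with hS
  have hlow : ∀ J ∈ S, W t x ≤ J := by
    rintro J ⟨u, γ, hadm, rfl, rfl⟩
    rw [← hW0]
    exact le_add_integral_of_subsolution_Icc hU hf hK₁ hA2 hL hWbd hWuc hsub ht hadm
  have hup : ∀ e > 0, ∃ J ∈ S, J ≤ W t x + e := by
    intro e he
    obtain ⟨u, γ, hadm, hγ, hle⟩ := exists_integral_add_le_of_supersolution_Icc hU hUne hf hK₀ hA1
      hK₁ hA2 hL hWbd hWuc hsup ht x he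
    rw [hW0] at hle
    exact ⟨_, ⟨u, γ, hadm, hγ, rfl⟩, hle⟩
  obtain ⟨J₀, hJ₀, -⟩ := hup 1 one_pos
  refine le_antisymm (le_csInf ⟨J₀, hJ₀⟩ hlow) (le_of_forall_pos_le_add fun e he => ?_)
  obtain ⟨J, hJ, hle⟩ := hup e he
  exact (csInf_le ⟨W t x, hlow⟩ hJ).trans hle
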